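/- There exists a universal constant c > 0 such that for every 0 < ε < 1 and every Schwartz function φ : ℝ → ℝ one has ‖(Λ − Λ^{1−ε})φ‖_{L¹(ℝ)} ≤ c ‖φ‖_{W^{2,1}(ℝ)} · ε, i.e. Λ^{1−ε} converges to Λ as ε → 0 at rate ε in L¹. -/

import Mathlib

open MeasureTheory Real Filter Topology Set

/-- Principal value integral over `ℝ` with singularity at the origin:
`I = p.v.∫_ℝ F(η) dη = lim_{δ → 0⁺} ∫_{δ < |η|} F(η) dη`. -/
def HasPV (F : ℝ → ℝ) (I : ℝ) : Prop :=
  Tendsto (fun δ : ℝ => ∫ η in {η : ℝ | δ < |η|}, F η) (𝓝[>] 0) (𝓝 I)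

/-- Principal value integral over `ℝ` with singularity at the point `c`. -/
def HasPVat (c : ℝ) (F : ℝ → ℝ) (I : ℝ) : Prop :=
  Tendsto (fun δ : ℝ => ∫ η in {η : ℝ | δ < |η - c|}, F η) (𝓝[>] 0) (𝓝 I)

/-- The finite-depth operator `Λ^{1-ε}` (depth normalized to `l = π/2`), defined as a
principal value:  `Λ^{1-ε}φ(x) = p.v.∫_ℝ (φ(x) - φ(x-η)) |tanh(η/2)|^ε / sinh²(η/2) dη`.
The case `ε = 0` is the operator `Λ`. -/
noncomputable def Lam (ε : ℝ) (φ : ℝ → ℝ) (x : ℝ) : ℝ :=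
  limUnder (𝓝[>] (0:ℝ))
    (fun δ : ℝ => ∫ η in {η : ℝ | δ < |η|},
      (φ x - φ (x - η)) * |Real.tanh (η / 2)| ^ ε / Real.sinh (η / 2) ^ 2)

theorem sq_mul_one_add_sq_le_sinh_half_sq (η : ℝ) :
    η ^ 2 * (1 + η ^ 2) ≤ 64 * sinh (η / 2) ^ 2 := by
  have sq_le_sinh_sq (y : ℝ) : y ^ 2 ≤ sinh y ^ 2 := by
    rw [sq_le_sq, abs_sinh]
    exact self_le_sinh_iff.2 (abs_nonneg y)
  have hdouble : sinh (η / 2) = 2 * sinh (η / 4) * cosh (η / 4) := by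
    rw [← sinh_two_mul]; ring_nf
  have h := sq_le_sinh_sq (η / 4)
  rw [hdouble, mul_pow, cosh_sq]
  nlinarith [mul_nonneg (sub_nonneg.2 h) (sq_nonneg (η / 4)),
    mul_nonneg (sub_nonneg.2 h) (sq_nonneg (sinh (η / 4)))]

theorem inv_sinh_half_sq_le {η : ℝ} (hη : η ≠ 0) :
    (sinh (η / 2) ^ 2)⁻¹ ≤ 64 * (η ^ 2)⁻¹ * (1 + η ^ 2)⁻¹ := by
  have hpos : 0 < η ^ 2 := by positivity
  have hs : sinh (η / 2) ≠ 0 := by simpa using hη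
  have h := sq_mul_one_add_sq_le_sinh_half_sq η
  have : 0 < sinh (η / 2) ^ 2 := by positivity
  rw [mul_assoc, ← mul_inv, ← div_eq_mul_inv, le_div_iff₀ (by positivity), inv_mul_le_iff₀ this]
  linarith

theorem tanh_half_pos {η : ℝ} (hη : 0 < η) : 0 < tanh (η / 2) := by
  rw [tanh_eq_sinh_div_cosh]
  exact div_pos (sinh_pos_iff.2 (by positivity)) (cosh_pos _)

theorem inv_tanh_half_le {η : ℝ} (hη : 0 < η) : (tanh (η / 2))⁻¹ ≤ 1 + 2 * η⁻¹ := by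
  have hs : 0 < sinh (η / 2) := sinh_pos_iff.2 (by positivity)
  have h1 : η / 2 ≤ sinh (η / 2) := self_le_sinh_iff.2 (by positivity)
  have h2 : exp (-(η / 2)) ≤ 1 := exp_le_one_iff.2 (by linarith)
  rw [tanh_eq_sinh_div_cosh, inv_div, div_le_iff₀ hs]
  have h3 := cosh_sub_sinh (η / 2)
  have h4 : 1 ≤ 2 * η⁻¹ * sinh (η / 2) := by
    calc (1 : ℝ) = 2 * η⁻¹ * (η / 2) := by field_simp
      _ ≤ _ := by gcongr
  linarith

theorem one_sub_rpow_le {t ε : ℝ} (ht : 0 < t) (hε : 0 ≤ ε) :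
    1 - t ^ ε ≤ 2 * ε * √(t⁻¹) := by
  have h1 : ε * log t + 1 ≤ t ^ ε := by
    rw [rpow_def_of_pos ht, mul_comm]
    exact add_one_le_exp _
  have h2 : -log t ≤ 2 * √(t⁻¹) := by
    rw [← log_inv]
    have h := log_le_self (sqrt_nonneg t⁻¹)
    rw [log_sqrt (by positivity)] at h
    linarith
  nlinarith [mul_le_mul_of_nonneg_left h2 hε]

theorem one_sub_tanh_half_rpow_le {η ε : ℝ} (hη : 0 < η) (hε : 0 ≤ ε) :
    1 - tanh (η / 2) ^ ε ≤ 2 * ε * (1 + 2 * η ^ (-(1 / 2) : ℝ)) := by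
  refine (one_sub_rpow_le (tanh_half_pos hη) hε).trans ?_
  gcongr
  refine sqrt_le_iff.2 ⟨by positivity, (inv_tanh_half_le hη).trans ?_⟩
  have h : (η ^ (-(1 / 2) : ℝ)) ^ 2 = η⁻¹ := by
    rw [← rpow_natCast, ← rpow_mul hη.le, ← rpow_neg_one]; norm_num
  have h0 : 0 ≤ η ^ (-(1 / 2) : ℝ) := by positivity
  have h1 : 0 ≤ η⁻¹ := by positivity
  nlinarith

/-- An integrable majorant for `η² (1 - tanh(η/2)^ε) / sinh²(η/2)`. -/
noncomputable def kernelMajorant (η : ℝ) : ℝ :=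
  (1 + 2 * η ^ (-(1 / 2) : ℝ)) * (1 + η ^ 2)⁻¹

theorem kernelMajorant_nonneg {η : ℝ} (hη : 0 < η) : 0 ≤ kernelMajorant η := by
  unfold kernelMajorant; positivity

theorem integrableOn_kernelMajorant : IntegrableOn kernelMajorant (Ioi 0) := by
  have hmeas : Measurable kernelMajorant := by unfold kernelMajorant; fun_prop
  rw [← Ioc_union_Ioi_eq_Ioi (zero_le_one' ℝ)]
  refine IntegrableOn.union ?_ ?_
  · have h : IntegrableOn (fun η : ℝ => 1 + 2 * η ^ (-(1 / 2) : ℝ)) (Ioc 0 1) := by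
      rw [← intervalIntegrable_iff_integrableOn_Ioc_of_le zero_le_one]
      exact intervalIntegrable_const.add
        ((intervalIntegral.intervalIntegrable_rpow' (by norm_num)).const_mul 2)
    refine h.mono' hmeas.aestronglyMeasurable ?_
    filter_upwards [ae_restrict_mem measurableSet_Ioc] with η hη
    rw [norm_of_nonneg (kernelMajorant_nonneg hη.1)]
    have h0 : 0 ≤ η ^ (-(1 / 2) : ℝ) := rpow_nonneg hη.1.le _
    exact mul_le_of_le_one_right (by positivity) (inv_le_one_of_one_le₀ (by nlinarith))
  · refine (integrable_inv_one_add_sq.const_mul 3).integrableOn.mono'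
      hmeas.aestronglyMeasurable ?_
    filter_upwards [ae_restrict_mem measurableSet_Ioi] with η hη
    have hη : 1 < η := hη
    rw [norm_of_nonneg (kernelMajorant_nonneg (by linarith))]
    have h0 : η ^ (-(1 / 2) : ℝ) ≤ 1 := rpow_le_one_of_one_le_of_nonpos hη.le (by norm_num)
    unfold kernelMajorant
    gcongr
    linarith

/-- The symmetric second difference `2φ(x) - φ(x-η) - φ(x+η)`. -/
def secondDiff (φ : ℝ → ℝ) (x η : ℝ) : ℝ := (φ x - φ (x - η)) + (φ x - φ (x + η))

theorem SchwartzMap.hasDerivAt_derivCLM (φ : SchwartzMap ℝ ℝ) (x : ℝ) :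
    HasDerivAt φ (derivCLM ℝ ℝ φ x) x :=
  φ.hasDerivAt x

theorem SchwartzMap.exists_abs_le (φ : SchwartzMap ℝ ℝ) : ∃ B, 0 ≤ B ∧ ∀ x, |φ x| ≤ B :=
  ⟨_, apply_nonneg _ _, fun x => φ.norm_le_seminorm ℝ x⟩

theorem abs_secondDiff_le (φ : SchwartzMap ℝ ℝ) (x : ℝ) {η : ℝ} (hη : 0 ≤ η) :
    |secondDiff φ x η| ≤
      η * ∫ s in Ioc (-η) η, ‖SchwartzMap.derivCLM ℝ ℝ (SchwartzMap.derivCLM ℝ ℝ φ) (x + s)‖ := by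
  set φ' := SchwartzMap.derivCLM ℝ ℝ φ
  set φ'' := SchwartzMap.derivCLM ℝ ℝ φ'
  have hcont : Continuous fun s => φ'' (x + s) := by fun_prop
  have hderiv (s : ℝ) :
      HasDerivAt (fun s => φ (x + s) + φ (x - s)) (φ' (x + s) - φ' (x - s)) s := by
    rw [sub_eq_add_neg]
    exact ((φ.hasDerivAt_derivCLM (x + s)).comp_const_add x s).add
      ((φ.hasDerivAt_derivCLM (x - s)).comp_const_sub x s)
  have hbound (s : ℝ) (hs : s ∈ Ico 0 η) :
      ‖φ' (x + s) - φ' (x - s)‖ ≤ ∫ r in Ioc (-η) η, ‖φ'' (x + r)‖ := by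
    have hle : -s ≤ s := by linarith [hs.1]
    have hftc : ∫ r in (-s)..s, φ'' (x + r) = φ' (x + s) - φ' (x - s) := by
      simpa only [sub_eq_add_neg] using intervalIntegral.integral_eq_sub_of_hasDerivAt
        (fun r _ => (φ'.hasDerivAt_derivCLM (x + r)).comp_const_add x r)
        (hcont.intervalIntegrable (-s) s)
    rw [← hftc, intervalIntegral.integral_of_le hle]
    refine (norm_integral_le_integral_norm _).trans (setIntegral_mono_set ?_ ?_ ?_)
    · exact (hcont.norm.integrableOn_Icc (a := -η) (b := η)).mono_set Ioc_subset_Icc_self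
    · exact Eventually.of_forall fun r => norm_nonneg _
    · exact (Ioc_subset_Ioc (by linarith [hs.2]) hs.2.le).eventuallyLE
  have h := norm_image_sub_le_of_norm_deriv_le_segment' (a := 0) (b := η)
    (fun s _ => (hderiv s).hasDerivWithinAt) hbound η (right_mem_Icc.2 hη)
  rw [mul_comm, ← abs_neg]
  convert h using 1
  · rw [Real.norm_eq_abs, secondDiff]; congr 1; simp; ring
  · ring

theorem lintegral_secondDiff_le (φ : SchwartzMap ℝ ℝ) {η : ℝ} (hη : 0 ≤ η) :
    ∫⁻ x, ‖secondDiff φ x η‖ₑ ≤ ENNReal.ofReal (2 * η ^ 2) *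
      ∫⁻ x, ‖SchwartzMap.derivCLM ℝ ℝ (SchwartzMap.derivCLM ℝ ℝ φ) x‖ₑ := by
  have hpt (x : ℝ) : ‖secondDiff φ x η‖ₑ ≤ ENNReal.ofReal η * ∫⁻ s in Ioc (-η) η,
      ‖SchwartzMap.derivCLM ℝ ℝ (SchwartzMap.derivCLM ℝ ℝ φ) (x + s)‖ₑ := by
    rw [← ofReal_integral_norm_eq_lintegral_enorm, ← ENNReal.ofReal_mul hη, ← ofReal_norm]
    · exact ENNReal.ofReal_le_ofReal (abs_secondDiff_le φ x hη)
    · exact (Continuous.integrableOn_Icc (by fun_prop)).mono_set Ioc_subset_Icc_self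
  refine (lintegral_mono hpt).trans ?_
  rw [lintegral_const_mul' _ _ ENNReal.ofReal_ne_top, lintegral_lintegral_swap]
  · simp_rw [lintegral_add_right_eq_self
      (fun x => ‖SchwartzMap.derivCLM ℝ ℝ (SchwartzMap.derivCLM ℝ ℝ φ) x‖ₑ)]
    rw [setLIntegral_const, Real.volume_Ioc, mul_comm (∫⁻ _, _), ← mul_assoc,
      ← ENNReal.ofReal_mul hη]
    refine le_of_eq ?_
    congr 2
    ring
  · exact Continuous.aemeasurable (by fun_prop)

theorem exists_abs_secondDiff_le (φ : SchwartzMap ℝ ℝ) :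
    ∃ C, 0 ≤ C ∧ ∀ x η, 0 ≤ η → |secondDiff φ x η| ≤ C * η ^ 2 := by
  obtain ⟨B, hB0, hB⟩ := (SchwartzMap.derivCLM ℝ ℝ (SchwartzMap.derivCLM ℝ ℝ φ)).exists_abs_le
  refine ⟨2 * B, by positivity, fun x η hη => (abs_secondDiff_le φ x hη).trans ?_⟩
  have h := norm_setIntegral_le_of_norm_le_const (μ := volume) (s := Ioc (-η) η) (C := B)
    (f := fun s => ‖SchwartzMap.derivCLM ℝ ℝ (SchwartzMap.derivCLM ℝ ℝ φ) (x + s)‖)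
    measure_Ioc_lt_top (fun s _ => by rw [norm_norm]; exact hB _)
  rw [Real.volume_real_Ioc_of_le (by linarith)] at h
  nlinarith [mul_le_mul_of_nonneg_left ((le_abs_self _).trans h) hη]

/-- The kernel `|tanh(η/2)|^ε / sinh²(η/2)` of `Lam ε`. -/
noncomputable def lamKernel (ε η : ℝ) : ℝ := |tanh (η / 2)| ^ ε / sinh (η / 2) ^ 2

theorem continuous_tanh : Continuous tanh := by
  simp_rw [funext tanh_eq_sinh_div_cosh]
  exact continuous_sinh.div continuous_cosh fun x => (cosh_pos x).ne'

theorem measurable_lamKernel (ε : ℝ) : Measurable (lamKernel ε) := by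
  have := continuous_tanh.measurable
  unfold lamKernel
  fun_prop

theorem lamKernel_nonneg (ε η : ℝ) : 0 ≤ lamKernel ε η := by
  unfold lamKernel; positivity

theorem lamKernel_neg (ε η : ℝ) : lamKernel ε (-η) = lamKernel ε η := by
  simp [lamKernel, neg_div]

theorem lamKernel_le {ε η : ℝ} (hε : 0 ≤ ε) (hη : η ≠ 0) :
    lamKernel ε η ≤ 64 * (η ^ 2)⁻¹ * (1 + η ^ 2)⁻¹ := by
  refine le_trans ?_ (inv_sinh_half_sq_le hη)
  rw [lamKernel, div_eq_mul_inv]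
  refine mul_le_of_le_one_left (by positivity) (rpow_le_one (abs_nonneg _) ?_ hε)
  exact (abs_tanh_lt_one _).le

theorem integrableOn_secondDiff_mul_lamKernel (φ : SchwartzMap ℝ ℝ) {ε : ℝ} (hε : 0 ≤ ε) (x : ℝ) :
    IntegrableOn (fun η => secondDiff φ x η * lamKernel ε η) (Ioi 0) := by
  obtain ⟨C, hC0, hC⟩ := exists_abs_secondDiff_le φ
  have hcont : Continuous (secondDiff φ x) := by unfold secondDiff; fun_prop
  refine (integrable_inv_one_add_sq.const_mul (64 * C)).integrableOn.mono'
    (hcont.measurable.mul (measurable_lamKernel ε)).aestronglyMeasurable ?_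
  filter_upwards [ae_restrict_mem measurableSet_Ioi] with η (hη : 0 < η)
  rw [norm_mul, norm_of_nonneg (lamKernel_nonneg _ _)]
  calc ‖secondDiff φ x η‖ * lamKernel ε η
      ≤ (C * η ^ 2) * (64 * (η ^ 2)⁻¹ * (1 + η ^ 2)⁻¹) :=
        mul_le_mul (hC x η hη.le) (lamKernel_le hε hη.ne') (lamKernel_nonneg _ _) (by positivity)
    _ = 64 * C * (1 + η ^ 2)⁻¹ := by field_simp

theorem integrableOn_sub_mul_lamKernel (φ : SchwartzMap ℝ ℝ) {ε : ℝ} (hε : 0 ≤ ε) (x : ℝ)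
    {δ : ℝ} (hδ : 0 < δ) :
    IntegrableOn (fun η => (φ x - φ (x - η)) * lamKernel ε η) {η | δ < |η|} := by
  obtain ⟨B, hB0, hB⟩ := φ.exists_abs_le
  have hcont : Continuous fun η => φ x - φ (x - η) := by fun_prop
  refine (integrable_inv_one_add_sq.const_mul (2 * B * (64 * (δ ^ 2)⁻¹))).integrableOn.mono'
    (hcont.measurable.mul (measurable_lamKernel ε)).aestronglyMeasurable ?_
  filter_upwards [ae_restrict_mem (measurableSet_lt measurable_const measurable_abs)]
    with η (hη : δ < |η|)
  have hη0 : η ≠ 0 := abs_pos.1 (hδ.trans hη)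
  have hsq : δ ^ 2 ≤ η ^ 2 := sq_le_sq.2 (by rw [abs_of_pos hδ]; exact hη.le)
  rw [norm_mul, norm_of_nonneg (lamKernel_nonneg _ _), mul_assoc]
  refine mul_le_mul ?_ ((lamKernel_le hε hη0).trans ?_) (lamKernel_nonneg _ _) (by positivity)
  · refine (norm_sub_le _ _).trans ?_
    linarith [hB x, hB (x - η), Real.norm_eq_abs (φ x), Real.norm_eq_abs (φ (x - η))]
  · gcongr

theorem integral_sub_mul_lamKernel_eq (φ : SchwartzMap ℝ ℝ) {ε : ℝ} (hε : 0 ≤ ε) (x : ℝ)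
    {δ : ℝ} (hδ : 0 < δ) :
    ∫ η in {η | δ < |η|}, (φ x - φ (x - η)) * lamKernel ε η =
      ∫ η in Ioi δ, secondDiff φ x η * lamKernel ε η := by
  have hint := integrableOn_sub_mul_lamKernel φ hε x hδ
  have hset : {η : ℝ | δ < |η|} = Iio (-δ) ∪ Ioi δ := by
    ext η; simp only [mem_ofPred_eq, lt_abs, mem_union, mem_Iio, mem_Ioi, lt_neg, or_comm]
  rw [hset, integrableOn_union] at hint
  have hdisj : Disjoint (Iio (-δ)) (Ioi δ) :=
    (Iio_disjoint_Ici le_rfl).mono_right fun η (hη : δ < η) => by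
      rw [mem_Ici]; linarith
  have hneg := hint.1.comp_neg_Ioi
  rw [hset, setIntegral_union hdisj measurableSet_Ioi hint.1 hint.2,
    ← integral_Iic_eq_integral_Iio, ← integral_comp_neg_Ioi, add_comm, ← integral_add hint.2 hneg]
  refine integral_congr_ae (Eventually.of_forall fun η => ?_)
  simp only [lamKernel_neg, secondDiff, sub_neg_eq_add, add_mul]

theorem Lam_eq_integral_Ioi (φ : SchwartzMap ℝ ℝ) {ε : ℝ} (hε : 0 ≤ ε) (x : ℝ) :
    Lam ε φ x = ∫ η in Ioi 0, secondDiff φ x η * lamKernel ε η := by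
  refine Tendsto.limUnder_eq ?_
  have hcover : AECover (volume.restrict (Ioi (0 : ℝ))) (𝓝[>] (0 : ℝ)) fun δ => Ioi δ :=
    aecover_Ioi_of_Ioi (tendsto_id.mono_right nhdsWithin_le_nhds)
  refine (hcover.integral_tendsto_of_countably_generated
    (integrableOn_secondDiff_mul_lamKernel φ hε x)).congr' ?_
  filter_upwards [self_mem_nhdsWithin] with δ (hδ : 0 < δ)
  rw [Measure.restrict_restrict measurableSet_Ioi,
    inter_eq_self_of_subset_left (Ioi_subset_Ioi hδ.le), ← integral_sub_mul_lamKernel_eq φ hε x hδ]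
  simp only [lamKernel, mul_div_assoc]

theorem Lam_zero_sub_Lam (φ : SchwartzMap ℝ ℝ) {ε : ℝ} (hε : 0 ≤ ε) (x : ℝ) :
    Lam 0 φ x - Lam ε φ x =
      ∫ η in Ioi 0, secondDiff φ x η * (lamKernel 0 η - lamKernel ε η) := by
  rw [Lam_eq_integral_Ioi φ le_rfl, Lam_eq_integral_Ioi φ hε,
    ← integral_sub (integrableOn_secondDiff_mul_lamKernel φ le_rfl x)
      (integrableOn_secondDiff_mul_lamKernel φ hε x)]
  simp only [mul_sub]

theorem abs_lamKernel_zero_sub_le {ε η : ℝ} (hε : 0 ≤ ε) (hη : 0 < η) :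
    |lamKernel 0 η - lamKernel ε η| * (2 * η ^ 2) ≤ 256 * ε * kernelMajorant η := by
  have ht := tanh_half_pos hη
  have heq : lamKernel 0 η - lamKernel ε η =
      (1 - tanh (η / 2) ^ ε) * (sinh (η / 2) ^ 2)⁻¹ := by
    simp only [lamKernel, rpow_zero, abs_of_pos ht]; ring
  have h0 : 0 ≤ 1 - tanh (η / 2) ^ ε :=
    sub_nonneg.2 (rpow_le_one ht.le (tanh_lt_one _).le hε)
  have hw : 0 ≤ η ^ (-(1 / 2) : ℝ) := by positivity
  rw [heq, abs_of_nonneg (by positivity)]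
  calc _ ≤ (2 * ε * (1 + 2 * η ^ (-(1 / 2) : ℝ))) * (64 * (η ^ 2)⁻¹ * (1 + η ^ 2)⁻¹) *
          (2 * η ^ 2) := by
        gcongr
        · exact one_sub_tanh_half_rpow_le hη hε
        · exact inv_sinh_half_sq_le hη.ne'
    _ = _ := by rw [kernelMajorant]; field_simp; ring

theorem lintegral_Lam_zero_sub_Lam_le (φ : SchwartzMap ℝ ℝ) {ε : ℝ} (hε : 0 ≤ ε) :
    ∫⁻ x, ‖Lam 0 φ x - Lam ε φ x‖ₑ ≤
      ENNReal.ofReal (256 * ε * ∫ η in Ioi 0, kernelMajorant η) *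
        ∫⁻ x, ‖SchwartzMap.derivCLM ℝ ℝ (SchwartzMap.derivCLM ℝ ℝ φ) x‖ₑ := by
  set I := ∫⁻ x, ‖SchwartzMap.derivCLM ℝ ℝ (SchwartzMap.derivCLM ℝ ℝ φ) x‖ₑ
  have hk : Measurable fun η => lamKernel 0 η - lamKernel ε η :=
    (measurable_lamKernel 0).sub (measurable_lamKernel ε)
  have hD : Continuous fun p : ℝ × ℝ => secondDiff φ p.1 p.2 := by unfold secondDiff; fun_prop
  calc ∫⁻ x, ‖Lam 0 φ x - Lam ε φ x‖ₑ
      ≤ ∫⁻ x, ∫⁻ η in Ioi 0, ‖secondDiff φ x η * (lamKernel 0 η - lamKernel ε η)‖ₑ :=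
        lintegral_mono fun x => by
          rw [Lam_zero_sub_Lam φ hε]; exact enorm_integral_le_lintegral_enorm _
    _ = ∫⁻ η in Ioi 0, ∫⁻ x, ‖secondDiff φ x η * (lamKernel 0 η - lamKernel ε η)‖ₑ :=
        lintegral_lintegral_swap
          (hD.measurable.mul (hk.comp measurable_snd)).enorm.aemeasurable
    _ ≤ ∫⁻ η in Ioi 0, ENNReal.ofReal (256 * ε * kernelMajorant η) * I := by
        refine setLIntegral_mono' measurableSet_Ioi fun η (hη : 0 < η) => ?_
        simp_rw [enorm_mul]
        rw [lintegral_mul_const' _ _ enorm_ne_top, mul_comm]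
        refine (mul_le_mul_right (lintegral_secondDiff_le φ hη.le) _).trans ?_
        rw [← mul_assoc, ← ofReal_norm, ← ENNReal.ofReal_mul (norm_nonneg _)]
        gcongr ?_ * I
        exact ENNReal.ofReal_le_ofReal (abs_lamKernel_zero_sub_le hε hη)
    _ = _ := by
        have hI : Integrable (fun η => 256 * ε * kernelMajorant η) (volume.restrict (Ioi 0)) :=
          integrableOn_kernelMajorant.const_mul _
        rw [lintegral_mul_const'' _ hI.aemeasurable.ennreal_ofReal,
          ← ofReal_integral_eq_lintegral_ofReal hI, integral_const_mul]
        filter_upwards [ae_restrict_mem measurableSet_Ioi] with η hη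
        have := kernelMajorant_nonneg hη
        positivity

theorem integral_abs_Lam_zero_sub_Lam_le (φ : SchwartzMap ℝ ℝ) {ε : ℝ} (hε : 0 ≤ ε) :
    ∫ x, |Lam 0 φ x - Lam ε φ x| ≤
      256 * ε * (∫ η in Ioi 0, kernelMajorant η) * ∫ x, |deriv (deriv φ) x| := by
  have hW : 0 ≤ ∫ η in Ioi 0, kernelMajorant η :=
    setIntegral_nonneg measurableSet_Ioi fun η hη => kernelMajorant_nonneg hη
  have h1 : ENNReal.ofReal (∫ x, |Lam 0 φ x - Lam ε φ x|) ≤ ∫⁻ x, ‖Lam 0 φ x - Lam ε φ x‖ₑ := by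
    rw [← Real.enorm_of_nonneg (integral_nonneg fun x => abs_nonneg _)]
    refine (enorm_integral_le_lintegral_enorm _).trans_eq ?_
    simp only [Real.enorm_abs]
  have h2 := h1.trans (lintegral_Lam_zero_sub_Lam_le φ hε)
  rw [← ofReal_integral_norm_eq_lintegral_enorm (SchwartzMap.integrable _),
    ← ENNReal.ofReal_mul (by positivity), ENNReal.ofReal_le_ofReal_iff (by positivity)] at h2
  exact h2

/-- There is a universal constant `c > 0` such that for every `0 < ε < 1`
and every Schwartz function `φ`, one has
`‖(Λ - Λ^{1-ε})φ‖_{L¹(ℝ)} ≤ c ‖φ‖_{W^{2,1}(ℝ)} ε`, where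
`‖φ‖_{W^{2,1}} = ‖φ‖_{L¹} + ‖∂_x φ‖_{L¹} + ‖∂_x² φ‖_{L¹}`. -/
theorem lam_converges_to_Lambda :
    ∃ c : ℝ, 0 < c ∧ ∀ (ε : ℝ), 0 < ε → ε < 1 → ∀ φ : SchwartzMap ℝ ℝ,
      (∫ x : ℝ, |Lam 0 (⇑φ) x - Lam ε (⇑φ) x|)
        ≤ c * ((∫ x : ℝ, |φ x|) + (∫ x : ℝ, |deriv (⇑φ) x|)
            + (∫ x : ℝ, |deriv (deriv (⇑φ)) x|)) * ε := by
  have hW : 0 ≤ ∫ η in Ioi 0, kernelMajorant η :=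
    setIntegral_nonneg measurableSet_Ioi fun η hη => kernelMajorant_nonneg hη
  refine ⟨256 * (∫ η in Ioi 0, kernelMajorant η) + 1, by positivity, fun ε hε _ φ => ?_⟩
  refine (integral_abs_Lam_zero_sub_Lam_le φ hε.le).trans ?_
  have h0 : 0 ≤ ∫ x, |φ x| := by positivity
  have h1 : 0 ≤ ∫ x, |deriv φ x| := by positivity
  have h2 : 0 ≤ ∫ x, |deriv (deriv φ) x| := by positivity
  rw [mul_right_comm 256, mul_right_comm]
  gcongr <;> linarith
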